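/- Let n be a positive integer, let 0 < x ≤ b, and set β = ⌈nb⌉/n. Then P(N_{nx} ≥ nβ) ≥ P(N_{nβ} = nβ)·exp(−n·H(β,x)) ≥ exp(−1/(12nβ))/√(2πnβ) · exp(−n·H(β,x)). -/

import Mathlib

open Real

/-- Poisson probability mass function with mean `lam`: `P(N_lam = j)`. -/
noncomputable def poissonProb (lam : ℝ) (j : ℕ) : ℝ := lam ^ j * Real.exp (-lam) / j.factorial

/-- Kullback–Leibler divergence between Poisson random variables with means `t` and `x`. -/
noncomputable def H (t x : ℝ) : ℝ := t * Real.log (t / x) - t + x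

namespace Stirling

open Filter Topology

/-- **Robbins' upper bound** for the Stirling sequence. -/
theorem log_stirlingSeq_le {n : ℕ} (hn : n ≠ 0) :
    Real.log (stirlingSeq n) ≤ Real.log (√π) + 1 / (12 * n) := by
  obtain ⟨m, rfl⟩ := Nat.exists_eq_succ_of_ne_zero hn
  have hmono : Monotone
      fun k : ℕ => Real.log (stirlingSeq (k + 1)) - 1 / (12 * ((k + 1 : ℕ) : ℝ)) := by
    refine monotone_nat_of_le_succ fun k => ?_
    have h := log_stirlingSeq_sdiff_le (k + 1)
    have e : (1 : ℝ) / (12 * ((k + 1 : ℕ) : ℝ) * (((k + 1 : ℕ) : ℝ) + 1)) =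
        1 / (12 * ((k + 1 : ℕ) : ℝ)) - 1 / (12 * ((k + 1 + 1 : ℕ) : ℝ)) := by
      push_cast
      field_simp
      ring
    linarith
  have hlog : Tendsto (fun k : ℕ => Real.log (stirlingSeq (k + 1))) atTop (𝓝 (Real.log (√π))) :=
    (tendsto_stirlingSeq_sqrt_pi.comp (tendsto_add_atTop_nat 1)).log (by positivity)
  have hinv : Tendsto (fun k : ℕ => 1 / (12 * ((k + 1 : ℕ) : ℝ))) atTop (𝓝 0) := by
    have h := (tendsto_one_div_add_atTop_nhds_zero_nat (𝕜 := ℝ)).const_mul (1 / 12)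
    rw [mul_zero] at h
    refine h.congr fun k => ?_
    push_cast
    field_simp
  have h := hmono.ge_of_tendsto (hlog.sub hinv) m
  rw [sub_zero] at h
  exact sub_le_iff_le_add.mp h

/-- Stirling's upper bound for `n!` with Robbins' error term. -/
theorem factorial_le_stirling {n : ℕ} (hn : n ≠ 0) :
    (n.factorial : ℝ) ≤ √(2 * π * n) * (n / rexp 1) ^ n * rexp (1 / (12 * n)) := by
  have hpos : 0 < stirlingSeq n := (by positivity : 0 < √π).trans_le (sqrt_pi_le_stirlingSeq hn)
  have h := Real.exp_le_exp.mpr (log_stirlingSeq_le hn)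
  rw [Real.exp_log hpos, Real.exp_add, Real.exp_log (by positivity), stirlingSeq,
    div_le_iff₀ (by positivity)] at h
  refine h.trans_eq ?_
  rw [show 2 * π * n = π * (2 * n) by ring, Real.sqrt_mul (by positivity) (2 * (n : ℝ))]
  ring

end Stirling

theorem poissonProb_nonneg {lam : ℝ} (hlam : 0 ≤ lam) (j : ℕ) : 0 ≤ poissonProb lam j := by
  unfold poissonProb
  positivity

theorem summable_poissonProb (lam : ℝ) : Summable (poissonProb lam) := by
  refine ((Real.summable_pow_div_factorial lam).mul_right (rexp (-lam))).congr fun j => ?_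
  unfold poissonProb
  ring

theorem poissonProb_le_tsum_tail {lam : ℝ} (hlam : 0 ≤ lam) (k : ℕ) :
    poissonProb lam k ≤ ∑' j : ℕ, if (k : ℝ) ≤ j then poissonProb lam j else 0 := by
  have hnonneg (j : ℕ) : 0 ≤ if (k : ℝ) ≤ j then poissonProb lam j else 0 := by
    split_ifs
    exacts [poissonProb_nonneg hlam j, le_rfl]
  have hsum : Summable fun j : ℕ => if (k : ℝ) ≤ j then poissonProb lam j else 0 := by
    refine (summable_poissonProb lam).of_nonneg_of_le hnonneg fun j => ?_
    split_ifs
    exacts [le_rfl, poissonProb_nonneg hlam j]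
  simpa using hsum.le_tsum k fun j _ => hnonneg j

/-- Change of mean in the Poisson mass function, in terms of the Kullback–Leibler divergence. -/
theorem poissonProb_mul_exp_neg_H {n k : ℕ} {t x : ℝ} (ht : 0 < t) (hx : 0 < x)
    (hk : (n : ℝ) * t = k) :
    poissonProb (n * t) k * rexp (-n * H t x) = poissonProb (n * x) k := by
  have hexp : rexp (-n * H t x) = (x / t) ^ k * rexp (n * t) * rexp (-(n * x)) := by
    rw [← Real.exp_log (show 0 < (x / t) ^ k by positivity), ← Real.exp_add, ← Real.exp_add,
      Real.log_pow, ← hk, H, Real.log_div ht.ne' hx.ne', Real.log_div hx.ne' ht.ne']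
    ring_nf
  have hcancel : rexp (-(n * t)) * rexp (n * t) = 1 := by rw [← Real.exp_add]; simp
  unfold poissonProb
  calc _ = ((n * t) * (x / t)) ^ k * (rexp (-(n * t)) * rexp (n * t)) * rexp (-(n * x)) /
        k.factorial := by rw [hexp, mul_pow (n * t)]; ring
    _ = _ := by rw [hcancel, mul_one, show n * t * (x / t) = n * x by field_simp]

theorem le_poissonProb_self {k : ℕ} (hk : k ≠ 0) :
    rexp (-1 / (12 * k)) / √(2 * π * k) ≤ poissonProb k k := by
  unfold poissonProb
  rw [div_le_div_iff₀ (by positivity) (by positivity)]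
  have hpow : ((k : ℝ) / rexp 1) ^ k = k ^ k * rexp (-k) := by
    rw [div_pow, ← Real.exp_nat_mul, mul_one, Real.exp_neg, div_eq_mul_inv]
  calc _ ≤ rexp (-1 / (12 * k)) *
        (√(2 * π * k) * (k / rexp 1) ^ k * rexp (1 / (12 * k))) := by
        gcongr
        exact Stirling.factorial_le_stirling hk
    _ = (k / rexp 1) ^ k * √(2 * π * k) * (rexp (-1 / (12 * k)) * rexp (1 / (12 * k))) := by ring
    _ = _ := by rw [← Real.exp_add, hpow, neg_div, neg_add_cancel, Real.exp_zero, mul_one]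

theorem poisson_right_tail_lower' (n : ℕ) (hn : 0 < n) (x b : ℝ) (hx : 0 < x) (hxb : x ≤ b)
    (β : ℝ) (hβ : β = (⌈(n : ℝ) * b⌉ : ℝ) / n) :
    poissonProb ((n : ℝ) * β) (⌈(n : ℝ) * b⌉).toNat * Real.exp (-(n : ℝ) * H β x) ≤
      (∑' k : ℕ, if (n : ℝ) * β ≤ k then poissonProb ((n : ℝ) * x) k else 0) ∧
    Real.exp (-1 / (12 * n * β)) / Real.sqrt (2 * π * n * β) * Real.exp (-(n : ℝ) * H β x) ≤
      poissonProb ((n : ℝ) * β) (⌈(n : ℝ) * b⌉).toNat * Real.exp (-(n : ℝ) * H β x) := by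
  have hn' : (0 : ℝ) < n := Nat.cast_pos.mpr hn
  have hceil : 0 < ⌈(n : ℝ) * b⌉ := Int.ceil_pos.mpr (mul_pos hn' (hx.trans_le hxb))
  obtain ⟨k, hk⟩ := Int.eq_ofNat_of_zero_le hceil.le
  rw [hk] at hβ hceil ⊢
  rw [Int.toNat_natCast]
  have hk0 : 0 < k := by exact_mod_cast hceil
  have hnβ : (n : ℝ) * β = k := by
    rw [hβ, mul_div_cancel₀ _ hn'.ne', Int.cast_natCast]
  have hβ0 : 0 < β := by
    refine pos_of_mul_pos_right (a := (n : ℝ)) ?_ hn'.le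
    rw [hnβ]
    exact_mod_cast hk0
  constructor
  · rw [poissonProb_mul_exp_neg_H hβ0 hx hnβ, hnβ]
    exact poissonProb_le_tsum_tail (by positivity) k
  · refine mul_le_mul_of_nonneg_right ?_ (Real.exp_nonneg _)
    rw [mul_assoc 12, mul_assoc (2 * π), hnβ]
    exact le_poissonProb_self hk0.ne'
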